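/- Let 1 ≤ p < ∞, 1 ≤ m < ∞, γ > -1, β ∈ ℝ with γ + βm/p + 1 < 0, and set w₁(t) = t⁻¹(1-log t)^γ, w₂(t) = (1-log t)^β. Then for every nonincreasing f_* : (0,1) → [0,∞), ∫₀¹ w₁(t)(∫₀ᵗ f_*(x)^p w₂(x) dx)^{m/p} dt is comparable to ∫₀¹ (1 - log t)^{γ + βm/p} (∫ₜ¹ f_*(x)^p dx)^{m/p} dt/t, with constants independent of f_*. -/

import Mathlib

open MeasureTheory Set ENNReal

/-- The dyadic blocks for `1 - log t`: the set where `2 ^ k < 1 - log t ≤ 2 ^ (k + 1)`. -/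
def logBlock (k : ℕ) : Set ℝ := Ico (Real.exp (1 - 2 ^ (k + 1))) (Real.exp (1 - 2 ^ k))

lemma mem_logBlock {k : ℕ} {t : ℝ} :
    t ∈ logBlock k ↔ 0 < t ∧ 2 ^ k < 1 - Real.log t ∧ 1 - Real.log t ≤ 2 ^ (k + 1) := by
  constructor
  · rintro ⟨h₁, h₂⟩
    have ht : 0 < t := (Real.exp_pos _).trans_le h₁
    rw [← Real.le_log_iff_exp_le ht] at h₁
    rw [← Real.log_lt_iff_lt_exp ht] at h₂
    exact ⟨ht, by linarith, by linarith⟩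
  · rintro ⟨ht, h₁, h₂⟩
    refine ⟨?_, ?_⟩
    · rw [← Real.le_log_iff_exp_le ht]; linarith
    · rw [← Real.log_lt_iff_lt_exp ht]; linarith

lemma measurableSet_logBlock (k : ℕ) : MeasurableSet (logBlock k) := measurableSet_Ico

lemma logBlock_index_lt_succ {j k : ℕ} {s t : ℝ} (hs : s ∈ logBlock j) (ht : t ∈ logBlock k)
    (hst : s ≤ t) : k < j + 1 := by
  rw [mem_logBlock] at hs ht
  have hlog : Real.log s ≤ Real.log t := Real.log_le_log hs.1 hst
  have : (2 : ℝ) ^ k < 2 ^ (j + 1) := by linarith [hs.2.2, ht.2.1]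
  exact (pow_lt_pow_iff_right₀ (by norm_num)).1 this

lemma lt_of_mem_logBlock {j k : ℕ} {s t : ℝ} (hs : s ∈ logBlock j) (ht : t ∈ logBlock k)
    (hkj : k < j) : s < t := by
  by_contra! h
  have := logBlock_index_lt_succ ht hs h
  omega

lemma logBlock_subset (k : ℕ) : logBlock k ⊆ Ioo 0 1 := by
  intro t ht
  rw [mem_logBlock] at ht
  have h1 : (1 : ℝ) ≤ 2 ^ k := one_le_pow₀ (by norm_num)
  exact ⟨ht.1, (Real.log_neg_iff ht.1).1 (by linarith [ht.2.1])⟩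

lemma pairwise_disjoint_logBlock : Pairwise (Function.onFun Disjoint logBlock) := by
  intro j k hjk
  rw [Function.onFun, Set.disjoint_left]
  intro t hj hk
  have h₁ := logBlock_index_lt_succ hj hk le_rfl
  have h₂ := logBlock_index_lt_succ hk hj le_rfl
  omega

lemma exists_mem_logBlock {t : ℝ} (ht : t ∈ Ioo (0 : ℝ) 1) : ∃ k, t ∈ logBlock k := by
  have hlog : Real.log t < 0 := Real.log_neg ht.1 ht.2
  have hex : ∃ n : ℕ, 1 - Real.log t ≤ 2 ^ (n + 1) := by
    obtain ⟨n, hn⟩ := pow_unbounded_of_one_lt (1 - Real.log t) (one_lt_two)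
    exact ⟨n, hn.le.trans (pow_le_pow_right₀ (by norm_num) (Nat.le_succ n))⟩
  classical
  refine ⟨Nat.find hex, mem_logBlock.2 ⟨ht.1, ?_, Nat.find_spec hex⟩⟩
  rcases h : Nat.find hex with _ | n
  · simp only [pow_zero]; linarith
  · exact not_le.1 (Nat.find_min hex (m := n) (by omega))

lemma iUnion_logBlock : ⋃ k, logBlock k = Ioo 0 1 :=
  Subset.antisymm (iUnion_subset logBlock_subset)
    fun _ ht ↦ mem_iUnion.2 (exists_mem_logBlock ht)

lemma lintegral_Ioo_eq_tsum_logBlock (h : ℝ → ℝ≥0∞) :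
    ∫⁻ t in Ioo (0 : ℝ) 1, h t = ∑' k, ∫⁻ t in logBlock k, h t := by
  rw [← iUnion_logBlock, lintegral_iUnion measurableSet_logBlock pairwise_disjoint_logBlock]

lemma exists_ofReal_one_sub_log_rpow {k : ℕ} {t : ℝ} (ht : t ∈ logBlock k) :
    ∃ w : ℝ, k ≤ w ∧ w ≤ k + 1 ∧
      ∀ e : ℝ, ENNReal.ofReal ((1 - Real.log t) ^ e) = (2 : ℝ≥0∞) ^ (e * w) := by
  rw [mem_logBlock] at ht
  have hk : (0 : ℝ) < 2 ^ k := by positivity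
  have hl : 0 < 1 - Real.log t := hk.trans ht.2.1
  refine ⟨Real.logb 2 (1 - Real.log t), ?_, ?_, fun e ↦ ?_⟩
  · rw [Real.le_logb_iff_rpow_le one_lt_two hl, Real.rpow_natCast]
    exact ht.2.1.le
  · rw [Real.logb_le_iff_le_rpow one_lt_two hl]
    exact_mod_cast ht.2.2
  · rw [mul_comm, ENNReal.rpow_mul, ← ENNReal.ofReal_rpow_of_pos hl]
    congr 1
    rw [show (2 : ℝ≥0∞) = ENNReal.ofReal 2 by simp, ENNReal.ofReal_rpow_of_pos two_pos,
      Real.rpow_logb two_pos (by norm_num) hl]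

lemma ofReal_one_sub_log_rpow_le {k : ℕ} {t : ℝ} (ht : t ∈ logBlock k) (e : ℝ) :
    ENNReal.ofReal ((1 - Real.log t) ^ e) ≤ 2 ^ |e| * 2 ^ (e * k) := by
  obtain ⟨w, h₁, h₂, hw⟩ := exists_ofReal_one_sub_log_rpow ht
  rw [hw, ← ENNReal.rpow_add _ _ two_ne_zero ofNat_ne_top]
  apply ENNReal.rpow_le_rpow_of_exponent_le one_le_two
  nlinarith [le_abs_self e, neg_abs_le e, abs_nonneg e]

lemma two_rpow_le_ofReal_one_sub_log_rpow {k : ℕ} {t : ℝ} (ht : t ∈ logBlock k) (e : ℝ) :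
    2 ^ (e * k) ≤ 2 ^ |e| * ENNReal.ofReal ((1 - Real.log t) ^ e) := by
  obtain ⟨w, h₁, h₂, hw⟩ := exists_ofReal_one_sub_log_rpow ht
  rw [hw, ← ENNReal.rpow_add _ _ two_ne_zero ofNat_ne_top]
  apply ENNReal.rpow_le_rpow_of_exponent_le one_le_two
  nlinarith [le_abs_self e, neg_abs_le e, abs_nonneg e]

lemma lintegral_inv_logBlock (k : ℕ) :
    ∫⁻ t in logBlock k, ENNReal.ofReal t⁻¹ = 2 ^ (k : ℝ) := by
  have h0 : 0 < Real.exp (1 - 2 ^ (k + 1)) := Real.exp_pos _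
  have hle : Real.exp (1 - 2 ^ (k + 1)) ≤ Real.exp (1 - 2 ^ k) :=
    Real.exp_le_exp.2 (by
      have : (2 : ℝ) ^ k ≤ 2 ^ (k + 1) := pow_le_pow_right₀ (by norm_num) (Nat.le_succ k)
      linarith)
  have hnot : (0 : ℝ) ∉ uIcc (Real.exp (1 - 2 ^ (k + 1))) (Real.exp (1 - 2 ^ k)) := by
    rw [uIcc_of_le hle]
    exact fun h ↦ absurd h.1 (not_le.2 h0)
  have hint : IntervalIntegrable (fun t : ℝ ↦ t⁻¹) volume
      (Real.exp (1 - 2 ^ (k + 1))) (Real.exp (1 - 2 ^ k)) :=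
    intervalIntegral.intervalIntegrable_inv (fun x hx h ↦ hnot (h ▸ hx)) continuousOn_id
  rw [logBlock, setLIntegral_congr Ico_ae_eq_Ioc,
    ← ofReal_integral_eq_lintegral_ofReal hint.1, ← intervalIntegral.integral_of_le hle,
    integral_inv hnot, Real.log_div (Real.exp_ne_zero _) (Real.exp_ne_zero _), Real.log_exp,
    Real.log_exp, ENNReal.rpow_natCast]
  · rw [show (1 : ℝ) - 2 ^ k - (1 - 2 ^ (k + 1)) = 2 ^ k by ring,
      ENNReal.ofReal_pow (by norm_num)]
    simp
  · filter_upwards [ae_restrict_mem measurableSet_Ioc] with t ht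
    exact inv_nonneg.2 (h0.trans ht.1).le

lemma lintegral_weight_logBlock_le (k : ℕ) (e : ℝ) :
    ∫⁻ t in logBlock k, ENNReal.ofReal (t⁻¹ * (1 - Real.log t) ^ e) ≤
      2 ^ |e| * 2 ^ ((e + 1) * k) := by
  calc _ ≤ ∫⁻ t in logBlock k, (2 ^ |e| * 2 ^ (e * k)) * ENNReal.ofReal t⁻¹ := by
        refine setLIntegral_mono' (measurableSet_logBlock k) fun t ht ↦ ?_
        rw [ENNReal.ofReal_mul (inv_nonneg.2 (logBlock_subset k ht).1.le), mul_comm]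
        gcongr
        exact ofReal_one_sub_log_rpow_le ht e
    _ = _ := by
        rw [lintegral_const_mul _ (by fun_prop), lintegral_inv_logBlock, mul_assoc,
          ← ENNReal.rpow_add _ _ two_ne_zero ofNat_ne_top, add_mul, one_mul]

lemma two_rpow_le_lintegral_weight_logBlock (k : ℕ) (e : ℝ) :
    2 ^ ((e + 1) * k) ≤
      2 ^ |e| * ∫⁻ t in logBlock k, ENNReal.ofReal (t⁻¹ * (1 - Real.log t) ^ e) := by
  calc (2 : ℝ≥0∞) ^ ((e + 1) * k)
      = ∫⁻ t in logBlock k, 2 ^ (e * k) * ENNReal.ofReal t⁻¹ := by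
        rw [lintegral_const_mul _ (by fun_prop), lintegral_inv_logBlock,
          ← ENNReal.rpow_add _ _ two_ne_zero ofNat_ne_top, add_mul, one_mul]
    _ ≤ ∫⁻ t in logBlock k, 2 ^ |e| * ENNReal.ofReal (t⁻¹ * (1 - Real.log t) ^ e) := by
        refine setLIntegral_mono' (measurableSet_logBlock k) fun t ht ↦ ?_
        rw [ENNReal.ofReal_mul (inv_nonneg.2 (logBlock_subset k ht).1.le),
          mul_comm (ENNReal.ofReal _), ← mul_assoc]
        gcongr
        exact two_rpow_le_ofReal_one_sub_log_rpow ht e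
    _ = _ := lintegral_const_mul _ (by fun_prop)

/-- Discrete Young-type inequality for a geometric kernel, valid for every exponent `r > 0`. -/
lemma exists_tsum_rpow_geometric_le {s : ℝ≥0∞} (hs : s < 1) {r : ℝ} (hr : 0 < r) :
    ∃ C : ℝ≥0∞, C ≠ ⊤ ∧ ∀ b : ℕ → ℝ≥0∞,
      ∑' k : ℕ, (∑' j : ℕ, (s * s) ^ ((j : ℤ) - k).natAbs * b j) ^ r ≤ C * ∑' j, b j ^ r := by
  have hfin : ∀ q : ℝ≥0∞, q < 1 → ∑' z : ℤ, q ^ z.natAbs ≠ ⊤ := by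
    intro q hq
    have hgeo : ∑' n : ℕ, q ^ n ≠ ⊤ := by
      rw [ENNReal.tsum_geometric]
      exact ENNReal.inv_ne_top.2 (tsub_pos_of_lt hq).ne'
    rw [tsum_of_nat_of_neg_add_one ENNReal.summable ENNReal.summable]
    refine ENNReal.add_ne_top.2 ⟨by simpa using hgeo, ne_top_of_le_ne_top hgeo ?_⟩
    calc ∑' n : ℕ, q ^ (-((n : ℤ) + 1)).natAbs = ∑' n : ℕ, q ^ (n + 1) := by
          refine tsum_congr fun n ↦ ?_
          congr 1
      _ ≤ _ := ENNReal.tsum_comp_le_tsum_of_injective (add_left_injective 1) _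
  have hker : ∀ (q : ℝ≥0∞) (k : ℕ),
      ∑' j : ℕ, q ^ ((j : ℤ) - k).natAbs ≤ ∑' z : ℤ, q ^ z.natAbs := fun q k ↦
    ENNReal.tsum_comp_le_tsum_of_injective (f := fun j : ℕ ↦ (j : ℤ) - k)
      (fun a b h ↦ by simpa using h) (fun z : ℤ ↦ q ^ z.natAbs)
  set A := ∑' z : ℤ, s ^ z.natAbs
  set B := ∑' z : ℤ, (s ^ r) ^ z.natAbs
  have hB : B ≠ ⊤ := hfin _ (ENNReal.rpow_lt_one hs hr)
  refine ⟨A ^ r * B, ENNReal.mul_ne_top (ENNReal.rpow_ne_top_of_nonneg hr.le (hfin s hs)) hB,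
    fun b ↦ ?_⟩
  have hterm : ∀ k : ℕ, (∑' j : ℕ, (s * s) ^ ((j : ℤ) - k).natAbs * b j) ^ r ≤
      A ^ r * ∑' j : ℕ, (s ^ r) ^ ((j : ℤ) - k).natAbs * b j ^ r := by
    intro k
    set M := (∑' j : ℕ, (s ^ r) ^ ((j : ℤ) - k).natAbs * b j ^ r)
    have hle : ∀ j : ℕ, s ^ ((j : ℤ) - k).natAbs * b j ≤ M ^ r⁻¹ := by
      intro j
      rw [ENNReal.le_rpow_inv_iff hr, ENNReal.mul_rpow_of_nonneg _ _ hr.le,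
        ← ENNReal.rpow_natCast_mul, mul_comm (_ : ℝ) r, ENNReal.rpow_mul_natCast]
      exact ENNReal.le_tsum (f := fun j : ℕ ↦ (s ^ r) ^ ((j : ℤ) - k).natAbs * b j ^ r) j
    calc _ ≤ (∑' j : ℕ, s ^ ((j : ℤ) - k).natAbs * M ^ r⁻¹) ^ r := by
          simp_rw [mul_pow, mul_assoc]
          gcongr with j
          exact hle j
      _ ≤ (A * M ^ r⁻¹) ^ r := by
          rw [ENNReal.tsum_mul_right]
          gcongr
          exact hker s k
      _ = A ^ r * M := by
          rw [ENNReal.mul_rpow_of_nonneg _ _ hr.le, ENNReal.rpow_inv_rpow hr.ne']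
  calc _ ≤ ∑' k : ℕ, A ^ r * ∑' j : ℕ, (s ^ r) ^ ((j : ℤ) - k).natAbs * b j ^ r :=
        ENNReal.tsum_le_tsum hterm
    _ = A ^ r * ∑' j : ℕ, (∑' k : ℕ, (s ^ r) ^ ((k : ℤ) - j).natAbs) * b j ^ r := by
        rw [ENNReal.tsum_mul_left, ENNReal.tsum_comm]
        congr 1
        refine tsum_congr fun j ↦ ?_
        rw [← ENNReal.tsum_mul_right]
        refine tsum_congr fun k ↦ ?_
        rw [← Int.natAbs_neg, neg_sub]
    _ ≤ A ^ r * ∑' j : ℕ, B * b j ^ r := by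
        gcongr with j
        exact hker _ j
    _ = _ := by rw [ENNReal.tsum_mul_left, mul_assoc]

/-- Discrete Hardy inequality with exponential weights: `J k` consists of indices `j` for which
the weight `2 ^ (δ * j)` is at least `2 ^ (δ * k)`. -/
lemma exists_tsum_hardy_le {δ r : ℝ} (hδ : δ ≠ 0) (hr : 0 < r) (J : ℕ → Set ℕ)
    (hJ : ∀ k, ∀ j ∈ J k, δ * ((k : ℝ) - j) ≤ 0) :
    ∃ C : ℝ≥0∞, C ≠ ⊤ ∧ ∀ a : ℕ → ℝ≥0∞,
      ∑' k : ℕ, 2 ^ (δ * k) * (∑' j : J k, a j) ^ r ≤ C * ∑' j : ℕ, 2 ^ (δ * j) * a j ^ r := by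
  have hs : (2 : ℝ≥0∞) ^ (-(|δ| / r / 2)) < 1 :=
    ENNReal.rpow_lt_one_of_one_lt_of_neg one_lt_two
      (neg_neg_of_pos (by have := abs_pos.2 hδ; positivity))
  obtain ⟨C, hC, h⟩ := exists_tsum_rpow_geometric_le hs hr
  have hpow : ∀ i : ℕ, (2 : ℝ≥0∞) ^ (δ * i) = (2 ^ (δ / r * i)) ^ r := by
    intro i
    rw [← ENNReal.rpow_mul]
    congr 1
    field_simp
  refine ⟨C, hC, fun a ↦ ?_⟩
  calc _ ≤ ∑' k : ℕ, (∑' j : ℕ, ((2 : ℝ≥0∞) ^ (-(|δ| / r / 2)) * 2 ^ (-(|δ| / r / 2))) ^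
        ((j : ℤ) - k).natAbs * (2 ^ (δ / r * j) * a j)) ^ r := by
        refine ENNReal.tsum_le_tsum fun k ↦ ?_
        rw [hpow, ← ENNReal.mul_rpow_of_nonneg _ _ hr.le, ← ENNReal.tsum_mul_left]
        gcongr
        refine le_trans (ENNReal.tsum_le_tsum fun j : J k ↦ ?_)
          (ENNReal.tsum_comp_le_tsum_of_injective Subtype.val_injective _)
        rw [← mul_assoc]
        gcongr
        rw [← ENNReal.rpow_add _ _ two_ne_zero ofNat_ne_top, ← ENNReal.rpow_mul_natCast,
          ← ENNReal.rpow_add _ _ two_ne_zero ofNat_ne_top]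
        apply ENNReal.rpow_le_rpow_of_exponent_le one_le_two
        have hj := hJ k j j.2
        have habs : (((((j : ℕ) : ℤ) - k).natAbs : ℕ) : ℝ) = |((j : ℕ) : ℝ) - k| := by
          rw [Nat.cast_natAbs]; push_cast; rfl
        rw [habs]
        have hmul : |δ| * |((j : ℕ) : ℝ) - k| = -(δ * ((k : ℝ) - (j : ℕ))) := by
          rw [← abs_mul, ← abs_of_nonpos hj, abs_mul, abs_mul, abs_sub_comm]
        have : (-(|δ| / r / 2) + -(|δ| / r / 2)) * |((j : ℕ) : ℝ) - k| =
            -(|δ| * |((j : ℕ) : ℝ) - k|) / r := by ring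
        rw [this, hmul]
        apply le_of_eq
        ring
    _ ≤ C * ∑' j : ℕ, (2 ^ (δ / r * j) * a j) ^ r := h _
    _ = _ := by simp_rw [ENNReal.mul_rpow_of_nonneg _ _ hr.le, ← hpow]

lemma lintegral_weight_mul_rpow_le (e : ℝ) {r : ℝ} (hr : 0 < r) (h : ℝ → ℝ≥0∞)
    (E : ℝ → Set ℝ) (J : ℕ → Set ℕ) (hE : ∀ k, ∀ t ∈ logBlock k, E t ⊆ ⋃ j : J k, logBlock j) :
    ∫⁻ t in Ioo (0 : ℝ) 1,
        ENNReal.ofReal (t⁻¹ * (1 - Real.log t) ^ e) * (∫⁻ x in E t, h x) ^ r ≤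
      2 ^ |e| * ∑' k : ℕ, 2 ^ ((e + 1) * k) * (∑' j : J k, ∫⁻ x in logBlock j, h x) ^ r := by
  rw [lintegral_Ioo_eq_tsum_logBlock, ← ENNReal.tsum_mul_left]
  refine ENNReal.tsum_le_tsum fun k ↦ ?_
  calc _ ≤ ∫⁻ t in logBlock k, ENNReal.ofReal (t⁻¹ * (1 - Real.log t) ^ e) *
        (∑' j : J k, ∫⁻ x in logBlock j, h x) ^ r := by
        refine setLIntegral_mono' (measurableSet_logBlock k) fun t ht ↦ ?_
        gcongr
        exact (lintegral_mono_set (hE k t ht)).trans (lintegral_iUnion_le _ _)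
    _ ≤ _ := by
        rw [lintegral_mul_const _ (by fun_prop), ← mul_assoc]
        gcongr
        exact lintegral_weight_logBlock_le k e

lemma two_rpow_mul_le_lintegral_weight (e : ℝ) {r : ℝ} (hr : 0 < r) (h : ℝ → ℝ≥0∞)
    (E : ℝ → Set ℝ) {j k : ℕ} (hE : ∀ t ∈ logBlock k, logBlock j ⊆ E t) :
    2 ^ ((e + 1) * k) * (∫⁻ x in logBlock j, h x) ^ r ≤
      2 ^ |e| * ∫⁻ t in logBlock k,
        ENNReal.ofReal (t⁻¹ * (1 - Real.log t) ^ e) * (∫⁻ x in E t, h x) ^ r := by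
  calc _ ≤ 2 ^ |e| * ((∫⁻ t in logBlock k, ENNReal.ofReal (t⁻¹ * (1 - Real.log t) ^ e)) *
        (∫⁻ x in logBlock j, h x) ^ r) := by
        rw [← mul_assoc]
        gcongr
        exact two_rpow_le_lintegral_weight_logBlock k e
    _ ≤ _ := by
        rw [← lintegral_mul_const _ (by fun_prop)]
        gcongr 2 ^ |e| * ?_
        refine setLIntegral_mono' (measurableSet_logBlock k) fun t ht ↦ ?_
        gcongr
        exact hE t ht

lemma lintegral_logBlock_mul_le (k : ℕ) (β : ℝ) (g : ℝ → ℝ≥0∞) :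
    ∫⁻ x in logBlock k, g x * ENNReal.ofReal ((1 - Real.log x) ^ β) ≤
      2 ^ |β| * (2 ^ (β * k) * ∫⁻ x in logBlock k, g x) := by
  rw [← mul_assoc, ← lintegral_const_mul' _ _ (by finiteness)]
  refine setLIntegral_mono' (measurableSet_logBlock k) fun t ht ↦ ?_
  rw [mul_comm]
  gcongr
  exact ofReal_one_sub_log_rpow_le ht β

lemma two_rpow_mul_lintegral_logBlock_le (k : ℕ) (β : ℝ) (g : ℝ → ℝ≥0∞) :
    2 ^ (β * k) * ∫⁻ x in logBlock k, g x ≤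
      2 ^ |β| * ∫⁻ x in logBlock k, g x * ENNReal.ofReal ((1 - Real.log x) ^ β) := by
  rw [← lintegral_const_mul' _ _ (by finiteness), ← lintegral_const_mul' _ _ (by finiteness)]
  refine setLIntegral_mono' (measurableSet_logBlock k) fun t ht ↦ ?_
  rw [mul_left_comm, mul_comm]
  gcongr
  exact two_rpow_le_ofReal_one_sub_log_rpow ht β

/-- The first two blocks carry comparable mass of a nonincreasing function. -/
lemma exists_lintegral_logBlock_zero_le :
    ∃ c : ℝ≥0∞, c ≠ ⊤ ∧ ∀ g : ℝ → ℝ≥0∞, AntitoneOn g (Ioo 0 1) →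
      ∫⁻ x in logBlock 0, g x ≤ c * ∫⁻ x in logBlock 1, g x := by
  have hlt : Real.exp (1 - 2 ^ (1 + 1)) < Real.exp (1 - 2 ^ 1) :=
    Real.exp_lt_exp.2 (by norm_num)
  have h1 : volume (logBlock 1) ≠ 0 := by
    rw [logBlock, Real.volume_Ico]
    exact (ENNReal.ofReal_pos.2 (sub_pos.2 hlt)).ne'
  have h1' : volume (logBlock 1) ≠ ⊤ := by
    rw [logBlock, Real.volume_Ico]; finiteness
  have h0 : volume (logBlock 0) ≠ ⊤ := by
    rw [logBlock, Real.volume_Ico]; finiteness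
  refine ⟨volume (logBlock 0) / volume (logBlock 1), ENNReal.div_ne_top h0 h1, fun g hg ↦ ?_⟩
  set u := Real.exp (1 - 2 ^ 1)
  have hu0 : u ∈ logBlock 0 := ⟨le_rfl, Real.exp_lt_exp.2 (by norm_num)⟩
  have hmem := logBlock_subset 0 hu0
  have hup : ∫⁻ x in logBlock 0, g x ≤ g u * volume (logBlock 0) := by
    rw [← setLIntegral_const]
    exact setLIntegral_mono' (measurableSet_logBlock 0) fun t ht ↦
      hg hmem (logBlock_subset 0 ht) ht.1
  have hlow : g u * volume (logBlock 1) ≤ ∫⁻ x in logBlock 1, g x := by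
    rw [← setLIntegral_const]
    exact setLIntegral_mono' (measurableSet_logBlock 1) fun t ht ↦
      hg (logBlock_subset 1 ht) hmem ht.2.le
  calc _ ≤ g u * volume (logBlock 0) := hup
    _ = volume (logBlock 0) / volume (logBlock 1) * (g u * volume (logBlock 1)) := by
        rw [mul_left_comm, ENNReal.div_mul_cancel h1 h1']
    _ ≤ _ := by gcongr

section Comparison

variable {γ β r : ℝ}

lemma exists_lintegral_Ioo_zero_le (hr : 0 < r) (hγ : -1 < γ) :
    ∃ C : ℝ≥0∞, C ≠ ⊤ ∧ ∀ g : ℝ → ℝ≥0∞,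
      ∫⁻ t in Ioo (0 : ℝ) 1, ENNReal.ofReal (t⁻¹ * (1 - Real.log t) ^ γ) *
          (∫⁻ x in Ioo (0 : ℝ) t, g x * ENNReal.ofReal ((1 - Real.log x) ^ β)) ^ r ≤
        C * ∑' k : ℕ, 2 ^ ((γ + β * r + 1) * k) * (∫⁻ x in logBlock k, g x) ^ r := by
  obtain ⟨C, hC, h⟩ := exists_tsum_hardy_le (δ := γ + 1) (by linarith) hr (fun k ↦ Ici k)
    (fun k j hj ↦ by
      have : (k : ℝ) ≤ j := by exact_mod_cast hj
      nlinarith)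
  refine ⟨2 ^ |γ| * (C * (2 ^ |β|) ^ r), by finiteness, fun g ↦ ?_⟩
  refine (lintegral_weight_mul_rpow_le γ hr _ (fun t ↦ Ioo 0 t) (fun k ↦ Ici k) ?_).trans ?_
  · intro k t ht x hx
    obtain ⟨j, hj⟩ := exists_mem_logBlock ⟨hx.1, hx.2.trans (logBlock_subset k ht).2⟩
    exact mem_iUnion.2
      ⟨⟨j, Nat.lt_succ_iff.1 (logBlock_index_lt_succ hj ht hx.2.le)⟩, hj⟩
  · rw [mul_assoc]
    gcongr
    refine (h fun j ↦ ∫⁻ x in logBlock j, g x * ENNReal.ofReal ((1 - Real.log x) ^ β)).trans ?_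
    rw [mul_assoc]
    gcongr
    rw [← ENNReal.tsum_mul_left]
    refine ENNReal.tsum_le_tsum fun k ↦ ?_
    calc _ ≤ 2 ^ ((γ + 1) * k) * (2 ^ |β| * (2 ^ (β * k) * ∫⁻ x in logBlock k, g x)) ^ r := by
          gcongr
          exact lintegral_logBlock_mul_le k β g
      _ = _ := by
          rw [ENNReal.mul_rpow_of_nonneg _ _ hr.le, ENNReal.mul_rpow_of_nonneg _ _ hr.le,
            ← ENNReal.rpow_mul _ (β * k), mul_left_comm, ← mul_assoc (2 ^ ((γ + 1) * (k : ℝ))),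
            ← ENNReal.rpow_add _ _ two_ne_zero ofNat_ne_top]
          ring_nf

lemma exists_lintegral_Ioo_one_le {e : ℝ} (hr : 0 < r) (he : e + 1 < 0) :
    ∃ C : ℝ≥0∞, C ≠ ⊤ ∧ ∀ g : ℝ → ℝ≥0∞,
      ∫⁻ t in Ioo (0 : ℝ) 1, ENNReal.ofReal (t⁻¹ * (1 - Real.log t) ^ e) *
          (∫⁻ x in Ioo t 1, g x) ^ r ≤
        C * ∑' k : ℕ, 2 ^ ((e + 1) * k) * (∫⁻ x in logBlock k, g x) ^ r := by
  obtain ⟨C, hC, h⟩ := exists_tsum_hardy_le (δ := e + 1) he.ne hr (fun k ↦ Iic k)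
    (fun k j hj ↦ by
      have : (j : ℝ) ≤ k := by exact_mod_cast hj
      nlinarith)
  refine ⟨2 ^ |e| * C, by finiteness, fun g ↦ ?_⟩
  refine (lintegral_weight_mul_rpow_le e hr _ (fun t ↦ Ioo t 1) (fun k ↦ Iic k) ?_).trans ?_
  · intro k t ht x hx
    obtain ⟨j, hj⟩ := exists_mem_logBlock ⟨(logBlock_subset k ht).1.trans hx.1, hx.2⟩
    exact mem_iUnion.2
      ⟨⟨j, Nat.lt_succ_iff.1 (logBlock_index_lt_succ ht hj hx.1.le)⟩, hj⟩
  · rw [mul_assoc]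
    gcongr
    exact h _

lemma tsum_logBlock_le_lintegral_Ioo_one (e : ℝ) (hr : 0 < r) (g : ℝ → ℝ≥0∞) :
    ∑' k : ℕ, 2 ^ ((e + 1) * k) * (∫⁻ x in logBlock k, g x) ^ r ≤
      2 ^ (-(e + 1)) * 2 ^ |e| * ∫⁻ t in Ioo (0 : ℝ) 1,
        ENNReal.ofReal (t⁻¹ * (1 - Real.log t) ^ e) * (∫⁻ x in Ioo t 1, g x) ^ r := by
  rw [lintegral_Ioo_eq_tsum_logBlock]
  refine le_trans ?_ (mul_le_mul_right
    (ENNReal.tsum_comp_le_tsum_of_injective (add_left_injective 1) _) _)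
  rw [← ENNReal.tsum_mul_left]
  refine ENNReal.tsum_le_tsum fun k ↦ ?_
  have hk := two_rpow_mul_le_lintegral_weight e hr g (fun t ↦ Ioo t 1) (j := k) (k := k + 1)
    fun t ht x hx ↦ ⟨lt_of_mem_logBlock ht hx (Nat.lt_succ_self k), (logBlock_subset k hx).2⟩
  rw [mul_assoc]
  refine le_trans (le_of_eq ?_) (mul_le_mul_right hk _)
  rw [← mul_assoc, ← ENNReal.rpow_add _ _ two_ne_zero ofNat_ne_top]
  push_cast
  ring_nf

lemma exists_tsum_logBlock_le_lintegral_Ioo_zero (γ β : ℝ) (hr : 0 < r) :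
    ∃ C : ℝ≥0∞, C ≠ ⊤ ∧ ∀ g : ℝ → ℝ≥0∞, AntitoneOn g (Ioo 0 1) →
      ∑' k : ℕ, 2 ^ ((γ + β * r + 1) * k) * (∫⁻ x in logBlock k, g x) ^ r ≤
        C * ∫⁻ t in Ioo (0 : ℝ) 1, ENNReal.ofReal (t⁻¹ * (1 - Real.log t) ^ γ) *
          (∫⁻ x in Ioo (0 : ℝ) t, g x * ENNReal.ofReal ((1 - Real.log x) ^ β)) ^ r := by
  obtain ⟨c, hc, h01⟩ := exists_lintegral_logBlock_zero_le
  set ε := γ + β * r + 1 with hε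
  set D : ℝ≥0∞ := 2 ^ (γ + 1) * (2 ^ |β|) ^ r * 2 ^ |γ| with hD
  refine ⟨(c ^ r * 2 ^ (-ε) + 1) * D, by finiteness, fun g hg ↦ ?_⟩
  set T : ℕ → ℝ≥0∞ := fun k ↦ 2 ^ (ε * k) * (∫⁻ x in logBlock k, g x) ^ r with hT
  have hsucc : ∑' k, T (k + 1) ≤ D * ∫⁻ t in Ioo (0 : ℝ) 1,
      ENNReal.ofReal (t⁻¹ * (1 - Real.log t) ^ γ) *
        (∫⁻ x in Ioo (0 : ℝ) t, g x * ENNReal.ofReal ((1 - Real.log x) ^ β)) ^ r := by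
    rw [lintegral_Ioo_eq_tsum_logBlock, ← ENNReal.tsum_mul_left]
    refine ENNReal.tsum_le_tsum fun k ↦ ?_
    have hk := two_rpow_mul_le_lintegral_weight γ hr
      (fun x ↦ g x * ENNReal.ofReal ((1 - Real.log x) ^ β)) (fun t ↦ Ioo 0 t)
      (j := k + 1) (k := k)
      fun t ht x hx ↦ ⟨(logBlock_subset _ hx).1, lt_of_mem_logBlock hx ht (Nat.lt_succ_self k)⟩
    calc T (k + 1) = 2 ^ (γ + 1) * (2 ^ ((γ + 1) * k) *
          (2 ^ (β * (k + 1 : ℕ)) * ∫⁻ x in logBlock (k + 1), g x) ^ r) := by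
          rw [ENNReal.mul_rpow_of_nonneg _ _ hr.le, ← ENNReal.rpow_mul, ← mul_assoc,
            ← mul_assoc, ← ENNReal.rpow_add _ _ two_ne_zero ofNat_ne_top,
            ← ENNReal.rpow_add _ _ two_ne_zero ofNat_ne_top]
          simp only [hT, hε]
          push_cast
          ring_nf
      _ ≤ 2 ^ (γ + 1) * (2 ^ ((γ + 1) * k) * (2 ^ |β| *
          ∫⁻ x in logBlock (k + 1), g x * ENNReal.ofReal ((1 - Real.log x) ^ β)) ^ r) := by
          gcongr 2 ^ (γ + 1) * (_ * ?_ ^ r)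
          exact two_rpow_mul_lintegral_logBlock_le (k + 1) β g
      _ = 2 ^ (γ + 1) * (2 ^ |β|) ^ r * (2 ^ ((γ + 1) * k) * (∫⁻ x in logBlock (k + 1),
          g x * ENNReal.ofReal ((1 - Real.log x) ^ β)) ^ r) := by
          rw [ENNReal.mul_rpow_of_nonneg _ _ hr.le]
          ring
      _ ≤ _ := by
          rw [hD, mul_assoc _ (2 ^ |γ|)]
          gcongr
  have hzero : T 0 ≤ c ^ r * 2 ^ (-ε) * T 1 := by
    simp only [hT, Nat.cast_zero, mul_zero, ENNReal.rpow_zero, one_mul, Nat.cast_one, mul_one]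
    rw [mul_assoc, ← mul_assoc (2 ^ (-ε)), ← ENNReal.rpow_add _ _ two_ne_zero ofNat_ne_top,
      neg_add_cancel, ENNReal.rpow_zero, one_mul, ← ENNReal.mul_rpow_of_nonneg _ _ hr.le]
    gcongr
    exact h01 g hg
  calc ∑' k, T k = T 0 + ∑' k, T (k + 1) := tsum_eq_zero_add' ENNReal.summable
    _ ≤ c ^ r * 2 ^ (-ε) * ∑' k, T (k + 1) + ∑' k, T (k + 1) := by
        gcongr
        exact hzero.trans (by gcongr; exact ENNReal.le_tsum (f := fun k ↦ T (k + 1)) 0)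
    _ = (c ^ r * 2 ^ (-ε) + 1) * ∑' k, T (k + 1) := by rw [add_mul, one_mul]
    _ ≤ _ := by
        rw [mul_assoc]
        gcongr

end Comparison

/-- For `1 ≤ p,m < ∞`, `γ > -1`, `β ∈ ℝ` with `γ + βm/p + 1 < 0`,
`w₁(t) = t⁻¹(1-log t)^γ`, `w₂(t) = (1-log t)^β`, and every nonincreasing nonnegative `f⋆`
on `(0,1)`, `∫₀¹ w₁(t)(∫₀ᵗ f⋆^p w₂)^{m/p} dt` is comparable to
`∫₀¹ (1-log t)^{γ+βm/p} (∫ₜ¹ f⋆^p)^{m/p} dt/t`, uniformly in `f⋆`. -/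
theorem stmt_7 (p m γ β : ℝ) (hp : 1 ≤ p) (hm : 1 ≤ m)
    (hγ : -1 < γ) (hγβ : γ + β * m / p + 1 < 0) :
    ∃ C : ℝ≥0∞, 0 < C ∧ C ≠ ⊤ ∧
      ∀ f : ℝ → ℝ, AntitoneOn f (Ioo 0 1) → (∀ x ∈ Ioo (0:ℝ) 1, 0 ≤ f x) →
        ((∫⁻ t in Ioo (0:ℝ) 1,
            ENNReal.ofReal (t⁻¹ * (1 - Real.log t) ^ γ) *
              (∫⁻ x in Ioo (0:ℝ) t,
                ENNReal.ofReal (f x ^ p * (1 - Real.log x) ^ β)) ^ (m/p)) ≤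
          C * ∫⁻ t in Ioo (0:ℝ) 1,
            ENNReal.ofReal ((1 - Real.log t) ^ (γ + β * m / p) * t⁻¹) *
              (∫⁻ x in Ioo t 1, ENNReal.ofReal (f x ^ p)) ^ (m/p)) ∧
        ((∫⁻ t in Ioo (0:ℝ) 1,
            ENNReal.ofReal ((1 - Real.log t) ^ (γ + β * m / p) * t⁻¹) *
              (∫⁻ x in Ioo t 1, ENNReal.ofReal (f x ^ p)) ^ (m/p)) ≤
          C * ∫⁻ t in Ioo (0:ℝ) 1,
            ENNReal.ofReal (t⁻¹ * (1 - Real.log t) ^ γ) *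
              (∫⁻ x in Ioo (0:ℝ) t,
                ENNReal.ofReal (f x ^ p * (1 - Real.log x) ^ β)) ^ (m/p)) := by
  have hr : 0 < m / p := by positivity
  have hexp : γ + β * m / p = γ + β * (m / p) := by rw [mul_div_assoc]
  rw [hexp] at hγβ ⊢
  obtain ⟨C₁, hC₁, h₁⟩ := exists_lintegral_Ioo_zero_le (β := β) hr hγ
  obtain ⟨C₂, hC₂, h₂⟩ := exists_lintegral_Ioo_one_le hr hγβ
  obtain ⟨C₃, hC₃, h₃⟩ := exists_tsum_logBlock_le_lintegral_Ioo_zero γ β hr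
  set e := γ + β * (m / p)
  set C₄ : ℝ≥0∞ := 2 ^ (-(e + 1)) * 2 ^ |e|
  refine ⟨C₁ * C₄ + C₂ * C₃ + 1, by positivity, by finiteness, fun f hf hf0 ↦ ?_⟩
  have hg : AntitoneOn (fun x ↦ ENNReal.ofReal (f x ^ p)) (Ioo 0 1) := fun x hx y hy hxy ↦
    ENNReal.ofReal_le_ofReal (Real.rpow_le_rpow (hf0 y hy) (hf hx hy hxy) (by linarith))
  have hL : (∫⁻ t in Ioo (0:ℝ) 1, ENNReal.ofReal (t⁻¹ * (1 - Real.log t) ^ γ) *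
        (∫⁻ x in Ioo (0:ℝ) t, ENNReal.ofReal (f x ^ p * (1 - Real.log x) ^ β)) ^ (m/p)) =
      ∫⁻ t in Ioo (0:ℝ) 1, ENNReal.ofReal (t⁻¹ * (1 - Real.log t) ^ γ) *
        (∫⁻ x in Ioo (0:ℝ) t,
          ENNReal.ofReal (f x ^ p) * ENNReal.ofReal ((1 - Real.log x) ^ β)) ^ (m/p) := by
    refine setLIntegral_congr_fun measurableSet_Ioo fun t ht ↦ ?_
    congr 2
    refine setLIntegral_congr_fun measurableSet_Ioo fun x hx ↦ ?_
    exact ENNReal.ofReal_mul (Real.rpow_nonneg (hf0 x ⟨hx.1, hx.2.trans ht.2⟩) p)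
  simp_rw [hL, mul_comm (_ ^ e) (_⁻¹ : ℝ)]
  constructor
  · calc _ ≤ C₁ * (C₄ * _) := (h₁ _).trans (by
          gcongr
          exact tsum_logBlock_le_lintegral_Ioo_one e hr _)
      _ ≤ _ := by
          rw [← mul_assoc, add_assoc]
          gcongr
          exact le_self_add
  · calc _ ≤ C₂ * (C₃ * _) := (h₂ _).trans (by
          gcongr
          exact h₃ _ hg)
      _ ≤ _ := by
          rw [← mul_assoc]
          gcongr
          exact le_add_self.trans le_self_add
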